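/- arXiv:math/0005150 — 5 statements merged into one kernel-verified Lean document; each statement's English description precedes it below -/
import Mathlib

section
/- (Commutative case of Corollary 3.8.) Let (Ω, μ) be an atomless probability space, 1 ≤ p < 2, and let (f_n) be a weakly null sequence in L^p(μ) such that the family (|f_n|^p)_{n∈ℕ} is uniformly integrable. Then there is a subsequence (f'_i) of (f_i) such that lim_{n→∞} n^{-1/p} ‖ε_1 y_1 + ⋯ + ε_n y_n‖_{L^p(μ)} = 0, the limit holding uniformly over all subsequences (y_i) of (f'_i) and all choices of scalars (ε_j) with |ε_j| ≤ 1 for all j. -/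
open MeasureTheory Filter
open scoped ENNReal NNReal BigOperators

noncomputable section

variable {E : Type*} [NormedAddCommGroup E] [NormedSpace ℝ E]

/-- `x` is `K`-equivalent to the usual `ℓ^q` basis. -/
def IsLqBasisEquiv (q K : ℝ) (x : ℕ → E) : Prop :=
  ∀ (s : Finset ℕ) (a : ℕ → ℝ),
    (1 / K) * (∑ k ∈ s, |a k| ^ q) ^ (1 / q) ≤ ‖∑ k ∈ s, a k • x k‖ ∧
      ‖∑ k ∈ s, a k • x k‖ ≤ K * (∑ k ∈ s, |a k| ^ q) ^ (1 / q)

/-- `x` is `K`-equivalent to the usual `ℓ^q_n` basis. -/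
def IsLqBasisEquivFin (q K : ℝ) {n : ℕ} (x : Fin n → E) : Prop :=
  ∀ a : Fin n → ℝ,
    (1 / K) * (∑ k, |a k| ^ q) ^ (1 / q) ≤ ‖∑ k, a k • x k‖ ∧
      ‖∑ k, a k • x k‖ ≤ K * (∑ k, |a k| ^ q) ^ (1 / q)

/-- `x` is `u`-unconditional. -/
def IsUnconditionalWith (u : ℝ) (x : ℕ → E) : Prop :=
  ∀ (s : Finset ℕ) (c ε : ℕ → ℝ), (∀ k ∈ s, |ε k| = 1) →
    ‖∑ k ∈ s, (ε k * c k) • x k‖ ≤ u * ‖∑ k ∈ s, c k • x k‖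

/-- `x` is unconditional. -/
def IsUnconditional (x : ℕ → E) : Prop :=
  ∃ u : ℝ, 1 ≤ u ∧ IsUnconditionalWith u x

/-- Finite version of `u`-unconditionality. -/
def IsUnconditionalWithFin (u : ℝ) {n : ℕ} (x : Fin n → E) : Prop :=
  ∀ (c ε : Fin n → ℝ), (∀ k, |ε k| = 1) →
    ‖∑ k, (ε k * c k) • x k‖ ≤ u * ‖∑ k, c k • x k‖

/-- The measure `μ` is atomless: every measurable set of positive measure contains a
measurable subset of strictly smaller positive measure. -/
def Atomless {Ω : Type*} [MeasurableSpace Ω] (μ : Measure Ω) : Prop :=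
  ∀ A : Set Ω, MeasurableSet A → 0 < μ A →
    ∃ B, B ⊆ A ∧ MeasurableSet B ∧ 0 < μ B ∧ μ B < μ A

/-- The family `(|f n|^p)` is uniformly integrable. -/
def UnifIntPow {Ω : Type*} [MeasurableSpace Ω] (μ : Measure Ω) (p : ℝ) (f : ℕ → Ω → ℝ) : Prop :=
  ∀ ε : ℝ, 0 < ε → ∃ δ : ℝ, 0 < δ ∧ ∀ n, ∀ A : Set Ω, MeasurableSet A →
    μ A ≤ ENNReal.ofReal δ → ∫ x in A, |f n x| ^ p ∂μ ≤ ε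

/-- `(f n)` is weakly null in `L^p(μ)`. -/
def WeaklyNullLp {Ω : Type*} [MeasurableSpace Ω] (μ : Measure Ω) (p : ℝ≥0∞)
    (f : ℕ → Lp ℝ p μ) : Prop :=
  ∀ q : ℝ≥0∞, p⁻¹ + q⁻¹ = 1 → ∀ g : Lp ℝ q μ,
    Tendsto (fun n => ∫ x, (f n : Ω → ℝ) x * (g : Ω → ℝ) x ∂μ) atTop (nhds 0)

/-- The `p`-modulus of uniform integrability. -/
def omegaP {Ω : Type*} [MeasurableSpace Ω] (μ : Measure Ω) (p : ℝ) (f : Ω → ℝ) (ε : ℝ) : ℝ :=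
  sSup {r : ℝ | ∃ A : Set Ω, MeasurableSet A ∧ μ A ≤ ENNReal.ofReal ε ∧
    r = (∫ x in A, |f x| ^ p ∂μ) ^ (1 / p)}


/-- The function `a ↦ (M² + a²)^(p/2)`: a smooth variant of `|a|^p` which is quadratic near `0`. -/
def smoothPow (p M a : ℝ) : ℝ := (M ^ 2 + a ^ 2) ^ (p / 2)

/-- The derivative of `smoothPow p M`. -/
def smoothPowDeriv (p M a : ℝ) : ℝ := p * a * (M ^ 2 + a ^ 2) ^ (p / 2 - 1)

lemma rpow_le_tangent {r w w' : ℝ} (hr0 : 0 ≤ r) (hr1 : r ≤ 1) (hw : 0 < w) (hw' : 0 ≤ w') :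
    w' ^ r ≤ w ^ r + r * w ^ (r - 1) * (w' - w) := by
  have h := rpow_one_add_le_one_add_mul_self (s := w' / w - 1) (p := r)
    (by have := div_nonneg hw' hw.le; linarith) hr0 hr1
  rw [add_sub_cancel, Real.div_rpow hw' hw.le, div_le_iff₀ (by positivity)] at h
  refine h.trans (le_of_eq ?_)
  rw [Real.rpow_sub_one hw.ne']
  field_simp

lemma smoothPow_nonneg (p M a : ℝ) : 0 ≤ smoothPow p M a := by
  unfold smoothPow; positivity

lemma sq_rpow_half {x : ℝ} (hx : 0 ≤ x) (s : ℝ) : (x ^ 2) ^ (s / 2) = x ^ s := by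
  rw [← Real.rpow_natCast, ← Real.rpow_mul hx]
  congr 1; push_cast; ring

lemma abs_rpow_le_smoothPow {p : ℝ} (hp : 0 ≤ p) (M a : ℝ) : |a| ^ p ≤ smoothPow p M a := by
  rw [← sq_rpow_half (abs_nonneg a), sq_abs, smoothPow]
  gcongr
  nlinarith [sq_nonneg M]

lemma smoothPow_le {p M : ℝ} (hp : 0 ≤ p) (hM : 0 ≤ M) (a : ℝ) :
    smoothPow p M a ≤ (M + |a|) ^ p := by
  rw [← sq_rpow_half (by positivity), smoothPow]
  gcongr
  nlinarith [sq_abs a, mul_nonneg hM (abs_nonneg a)]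

lemma abs_smoothPowDeriv_le_rpow {p M : ℝ} (hp : 1 ≤ p) (hM : 0 < M) (a : ℝ) :
    |smoothPowDeriv p M a| ≤ p * (M ^ 2 + a ^ 2) ^ ((p - 1) / 2) := by
  have hw : 0 < M ^ 2 + a ^ 2 := by positivity
  have h1 : |a| ≤ (M ^ 2 + a ^ 2) ^ ((1 : ℝ) / 2) := by
    rw [← Real.sqrt_eq_rpow]
    exact Real.abs_le_sqrt (by nlinarith [sq_nonneg M])
  rw [smoothPowDeriv, abs_mul, abs_mul, abs_of_nonneg (by linarith : 0 ≤ p),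
    abs_of_nonneg (Real.rpow_nonneg hw.le _), mul_assoc]
  gcongr
  calc |a| * (M ^ 2 + a ^ 2) ^ (p / 2 - 1)
      ≤ (M ^ 2 + a ^ 2) ^ ((1 : ℝ) / 2) * (M ^ 2 + a ^ 2) ^ (p / 2 - 1) := by gcongr
    _ = _ := by rw [← Real.rpow_add hw]; congr 1; ring

lemma abs_smoothPowDeriv_le {p M : ℝ} (hp : 1 ≤ p) (hM : 0 < M) (a : ℝ) :
    |smoothPowDeriv p M a| ≤ p * (M + |a|) ^ (p - 1) := by
  refine (abs_smoothPowDeriv_le_rpow hp hM a).trans ?_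
  rw [← sq_rpow_half (by positivity) (p - 1)]
  gcongr
  nlinarith [sq_abs a, mul_nonneg hM.le (abs_nonneg a)]

lemma smoothPow_add_le_tangent {p M : ℝ} (hp1 : 1 ≤ p) (hp2 : p ≤ 2) (hM : 0 < M) (a b : ℝ) :
    smoothPow p M (a + b) ≤ smoothPow p M a + smoothPowDeriv p M a * b
      + p / 2 * (M ^ 2 + a ^ 2) ^ (p / 2 - 1) * b ^ 2 := by
  have h := rpow_le_tangent (r := p / 2) (w := M ^ 2 + a ^ 2) (w' := M ^ 2 + (a + b) ^ 2)
    (by linarith) (by linarith) (by positivity) (by positivity)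
  unfold smoothPow smoothPowDeriv
  refine h.trans (le_of_eq ?_)
  ring

lemma smoothPow_add_le_sq {p M : ℝ} (hp1 : 1 ≤ p) (hp2 : p ≤ 2) (hM : 0 < M) (a b : ℝ) :
    smoothPow p M (a + b) ≤ smoothPow p M a + smoothPowDeriv p M a * b
      + M ^ (p - 2) * b ^ 2 := by
  refine (smoothPow_add_le_tangent hp1 hp2 hM a b).trans ?_
  have h1 : (M ^ 2 + a ^ 2) ^ (p / 2 - 1) ≤ M ^ (p - 2) := by
    rw [← sq_rpow_half hM.le (p - 2), show (p - 2) / 2 = p / 2 - 1 by ring]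
    exact Real.rpow_le_rpow_of_nonpos (by positivity) (by nlinarith [sq_nonneg a]) (by linarith)
  have h2 : p / 2 * (M ^ 2 + a ^ 2) ^ (p / 2 - 1) ≤ 1 * M ^ (p - 2) := by
    gcongr
    linarith
  rw [one_mul] at h2
  gcongr

lemma smoothPow_add_le_rpow {p M : ℝ} (hp1 : 1 ≤ p) (hp2 : p ≤ 2) (hM : 0 < M) (a b : ℝ) :
    smoothPow p M (a + b) ≤ smoothPow p M a + smoothPowDeriv p M a * b + 6 * |b| ^ p := by
  have hw : 0 < M ^ 2 + a ^ 2 := by positivity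
  rcases le_or_gt (b ^ 2) (M ^ 2 + a ^ 2) with hb | hb
  · refine (smoothPow_add_le_tangent hp1 hp2 hM a b).trans ?_
    have h0 : (M ^ 2 + a ^ 2) ^ (p / 2 - 1) * b ^ 2 ≤ |b| ^ p := by
      rcases eq_or_ne b 0 with rfl | hb0
      · simp [Real.zero_rpow (by linarith : p ≠ 0)]
      have hb1 : 0 < b ^ 2 := by positivity
      calc (M ^ 2 + a ^ 2) ^ (p / 2 - 1) * b ^ 2 ≤ (b ^ 2) ^ (p / 2 - 1) * b ^ 2 := by
            gcongr ?_ * _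
            exact Real.rpow_le_rpow_of_nonpos hb1 hb (by linarith)
        _ = (b ^ 2) ^ (p / 2) := by rw [Real.rpow_sub_one hb1.ne']; field_simp
        _ = |b| ^ p := by rw [← sq_abs, sq_rpow_half (abs_nonneg b)]
    have h1 : 0 ≤ |b| ^ p := by positivity
    rw [mul_assoc (p / 2)]
    nlinarith
  · have hb0 : 0 < |b| := by
      rw [abs_pos]; rintro rfl; norm_num at hb; linarith
    have h1 : smoothPow p M (a + b) ≤ 4 * |b| ^ p := by
      have : smoothPow p M (a + b) ≤ ((2 * |b|) ^ 2) ^ (p / 2) := by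
        unfold smoothPow
        gcongr
        rw [mul_pow, sq_abs]
        nlinarith [sq_nonneg (a - b), sq_nonneg M]
      rw [sq_rpow_half (by positivity), Real.mul_rpow (by norm_num) (by positivity)] at this
      refine this.trans ?_
      gcongr
      calc (2 : ℝ) ^ p ≤ 2 ^ (2 : ℝ) := by gcongr; norm_num
        _ = 4 := by norm_num
    have h2 : |smoothPowDeriv p M a * b| ≤ 2 * |b| ^ p := by
      rw [abs_mul]
      calc |smoothPowDeriv p M a| * |b| ≤ (p * (M ^ 2 + a ^ 2) ^ ((p - 1) / 2)) * |b| := by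
            gcongr; exact abs_smoothPowDeriv_le_rpow hp1 hM a
        _ ≤ (2 * (b ^ 2) ^ ((p - 1) / 2)) * |b| := by gcongr
        _ = 2 * |b| ^ p := by
            rw [← sq_abs, sq_rpow_half (abs_nonneg b), Real.rpow_sub_one hb0.ne']
            field_simp
    have h3 := smoothPow_nonneg p M a
    have h4 := (abs_le.1 h2).1
    linarith

lemma smoothPow_add_le {p M L : ℝ} (hp1 : 1 ≤ p) (hp2 : p ≤ 2) (hM : 0 < M) (a b : ℝ) :
    smoothPow p M (a + b) ≤ smoothPow p M a + smoothPowDeriv p M a * b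
      + (6 * (if L < |b| then |b| ^ p else 0) + M ^ (p - 2) * L ^ 2) := by
  have h0 : 0 ≤ M ^ (p - 2) * L ^ 2 := by positivity
  split_ifs with h
  · linarith [smoothPow_add_le_rpow hp1 hp2 hM a b]
  · have h1 : M ^ (p - 2) * b ^ 2 ≤ M ^ (p - 2) * L ^ 2 := by
      gcongr ?_ * ?_
      rw [← sq_abs]
      exact pow_le_pow_left₀ (abs_nonneg b) (not_lt.1 h) 2
    linarith [smoothPow_add_le_sq hp1 hp2 hM a b]

lemma continuous_smoothPow {p M : ℝ} (hM : 0 < M) : Continuous (smoothPow p M) := by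
  unfold smoothPow
  exact Continuous.rpow_const (by fun_prop) fun a => Or.inl (by positivity)

lemma continuous_smoothPowDeriv {p M : ℝ} (hM : 0 < M) : Continuous (smoothPowDeriv p M) := by
  unfold smoothPowDeriv
  exact Continuous.mul (by fun_prop)
    (Continuous.rpow_const (by fun_prop) fun a => Or.inl (by positivity))

section

variable {Ω : Type*} [MeasurableSpace Ω] {μ : Measure Ω}

lemma ofReal_inv_add_inv_div_sub_one {p : ℝ} (hp : 1 ≤ p) :
    (ENNReal.ofReal p)⁻¹ + (ENNReal.ofReal p / ENNReal.ofReal (p - 1))⁻¹ = 1 := by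
  have h0 : ENNReal.ofReal p ≠ 0 := by simp; linarith
  rw [ENNReal.inv_div (Or.inl ENNReal.ofReal_ne_top) (Or.inr h0), ← one_div,
    ← ENNReal.add_div, ← ENNReal.ofReal_one, ← ENNReal.ofReal_add zero_le_one (by linarith),
    add_sub_cancel, ENNReal.div_self h0 ENNReal.ofReal_ne_top, ENNReal.ofReal_one]

lemma MeasureTheory.MemLp.integrable_abs_rpow {p : ℝ} (hp : 1 ≤ p) {u : Ω → ℝ}
    (hu : MemLp u (ENNReal.ofReal p) μ) : Integrable (fun x => |u x| ^ p) μ := by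
  have h := hu.integrable_norm_rpow (by simp; linarith) ENNReal.ofReal_ne_top
  simpa [ENNReal.toReal_ofReal (by linarith : 0 ≤ p)] using h

lemma MeasureTheory.MemLp.integrable_smoothPow [IsFiniteMeasure μ] {p M : ℝ} (hp : 1 ≤ p)
    (hM : 0 < M) {u : Ω → ℝ} (hu : MemLp u (ENNReal.ofReal p) μ) :
    Integrable (fun x => smoothPow p M (u x)) μ := by
  have h : MemLp (fun x => M + |u x|) (ENNReal.ofReal p) μ := (memLp_const M).add hu.abs
  refine (h.integrable_abs_rpow hp).mono'
    ((continuous_smoothPow hM).comp_aestronglyMeasurable hu.1) (ae_of_all _ fun x => ?_)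
  rw [Real.norm_of_nonneg (smoothPow_nonneg _ _ _), abs_of_nonneg (by positivity)]
  exact smoothPow_le (by linarith) hM.le _

lemma MeasureTheory.MemLp.smoothPowDeriv [IsFiniteMeasure μ] {p M : ℝ} (hp : 1 ≤ p)
    (hM : 0 < M) {u : Ω → ℝ} (hu : MemLp u (ENNReal.ofReal p) μ) :
    MemLp (fun x => smoothPowDeriv p M (u x)) (ENNReal.ofReal p / ENNReal.ofReal (p - 1)) μ := by
  have h : MemLp (fun x => M + |u x|) (ENNReal.ofReal p) μ := (memLp_const M).add hu.abs
  refine ((h.norm_rpow_div (ENNReal.ofReal (p - 1))).const_mul p).mono'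
    ((continuous_smoothPowDeriv hM).comp_aestronglyMeasurable hu.1) (ae_of_all _ fun x => ?_)
  rw [ENNReal.toReal_ofReal (by linarith), Real.norm_eq_abs, Real.norm_eq_abs,
    abs_of_nonneg (by positivity : 0 ≤ M + |u x|)]
  exact abs_smoothPowDeriv_le hp hM _

lemma integral_smoothPow_add_le [IsProbabilityMeasure μ] {p M L : ℝ} (hp1 : 1 ≤ p) (hp2 : p ≤ 2)
    (hM : 0 < M) {u v : Ω → ℝ} (hu : MemLp u (ENNReal.ofReal p) μ)
    (hv : MemLp v (ENNReal.ofReal p) μ) (hvm : Measurable v) {c : ℝ} (hc : |c| = 1) :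
    ∫ x, smoothPow p M (u x + c * v x) ∂μ ≤ ∫ x, smoothPow p M (u x) ∂μ
      + c * ∫ x, v x * smoothPowDeriv p M (u x) ∂μ
      + (6 * ∫ x in {x | L < |v x|}, |v x| ^ p ∂μ + M ^ (p - 2) * L ^ 2) := by
  have hms : MeasurableSet {x | L < |v x|} := measurableSet_lt measurable_const hvm.abs
  have : ENNReal.HolderConjugate (ENNReal.ofReal p) (ENNReal.ofReal p / ENNReal.ofReal (p - 1)) :=
    ENNReal.holderConjugate_iff.2 (ofReal_inv_add_inv_div_sub_one hp1)
  have i1 := hu.integrable_smoothPow hp1 hM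
  have i2 : Integrable (fun x => c * (v x * smoothPowDeriv p M (u x))) μ :=
    (hv.integrable_mul (hu.smoothPowDeriv hp1 hM)).const_mul c
  have i3 : Integrable (fun x => 6 * {x | L < |v x|}.indicator (fun x => |v x| ^ p) x) μ :=
    ((hv.integrable_abs_rpow hp1).indicator hms).const_mul 6
  have i4 : Integrable (fun _ : Ω => M ^ (p - 2) * L ^ 2) μ := integrable_const _
  calc ∫ x, smoothPow p M (u x + c * v x) ∂μ
      ≤ ∫ x, (smoothPow p M (u x) + c * (v x * smoothPowDeriv p M (u x))
        + (6 * {x | L < |v x|}.indicator (fun x => |v x| ^ p) x + M ^ (p - 2) * L ^ 2)) ∂μ := by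
        refine integral_mono ((hu.add (hv.const_mul c)).integrable_smoothPow hp1 hM)
          ((i1.add i2).add (i3.add i4)) fun x => ?_
        refine (smoothPow_add_le (L := L) hp1 hp2 hM (u x) (c * v x)).trans (le_of_eq ?_)
        rw [abs_mul, hc, one_mul, Set.indicator_apply]
        simp only [Set.mem_ofPred_eq]
        ring
    _ = _ := by
        rw [integral_add (by exact i1.add i2) (by exact i3.add i4), integral_add i1 i2,
          integral_add i3 i4,
          integral_const_mul, integral_const_mul, integral_indicator hms]
        simp

lemma norm_rpow_eq_integral {p : ℝ} (hp : 1 ≤ p) (u : Lp ℝ (ENNReal.ofReal p) μ) :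
    ‖u‖ ^ p = ∫ x, |u x| ^ p ∂μ := by
  have hp0 : 0 < p := by linarith
  rw [Lp.norm_def, toReal_eLpNorm (Lp.aestronglyMeasurable u),
    lpNorm_eq_integral_norm_rpow_toReal (by simpa using hp0) ENNReal.ofReal_ne_top
      (Lp.aestronglyMeasurable u), ENNReal.toReal_ofReal hp0.le,
    Real.rpow_inv_rpow (integral_nonneg fun x => by positivity) hp0.ne']
  simp

lemma exists_integral_abs_le_of_weaklyNullLp [IsProbabilityMeasure μ] {p : ℝ} (hp : 1 ≤ p)
    [Fact (1 ≤ ENNReal.ofReal p)] {f : ℕ → Lp ℝ (ENNReal.ofReal p) μ}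
    (hweak : WeaklyNullLp μ (ENNReal.ofReal p) f) :
    ∃ C : ℝ, ∀ n, ∫ x, |f n x| ∂μ ≤ C := by
  set q := ENNReal.ofReal p / ENNReal.ofReal (p - 1) with hq
  have hpq := ofReal_inv_add_inv_div_sub_one hp
  have hconj : ENNReal.HolderConjugate (ENNReal.ofReal p) q :=
    ENNReal.holderConjugate_iff.2 hpq
  have hq1 : Fact (1 ≤ q) := by
    refine ⟨?_⟩
    rw [← ENNReal.inv_le_inv, inv_one, ← hpq]
    exact le_add_self
  let T : ℕ → Lp ℝ q μ →L[ℝ] ℝ := fun n =>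
    (ContinuousLinearMap.mul ℝ ℝ).lpPairing μ (ENNReal.ofReal p) q (f n)
  have hT : ∀ n g, T n g = ∫ x, f n x * g x ∂μ := fun n g =>
    (ContinuousLinearMap.mul ℝ ℝ).lpPairing_eq_integral (f n) g
  obtain ⟨C, hC⟩ := banach_steinhaus (g := T) fun g => by
    obtain ⟨C, hC⟩ := (hweak q hpq g).norm.bddAbove_range
    exact ⟨C, fun n => by rw [hT]; exact hC ⟨n, rfl⟩⟩
  refine ⟨C, fun n => ?_⟩
  let s : Ω → ℝ := fun x => if 0 ≤ f n x then 1 else -1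
  have hs : ∀ x, ‖s x‖ ≤ 1 := fun x => by
    dsimp only [s]
    split_ifs <;> simp
  have hsm : AEStronglyMeasurable s μ :=
    (Measurable.ite (measurableSet_le measurable_const (Lp.stronglyMeasurable (f n)).measurable)
      measurable_const measurable_const).aestronglyMeasurable
  have hmem : MemLp s q μ :=
    MemLp.of_bound hsm 1 (ae_of_all _ hs)
  have hnorm : ‖hmem.toLp‖ ≤ 1 := by
    have := Lp.norm_le_of_ae_bound (μ := μ) (p := q) (f := hmem.toLp) zero_le_one
      (by filter_upwards [hmem.coeFn_toLp] with x hx; rw [hx]; exact hs x)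
    simpa [measureUnivNNReal, -Lp.norm_toLp] using this
  calc ∫ x, |f n x| ∂μ = T n hmem.toLp := by
        rw [hT]
        refine integral_congr_ae ?_
        filter_upwards [hmem.coeFn_toLp] with x hx
        rw [hx]
        dsimp only [s]
        split_ifs with h
        · rw [abs_of_nonneg h, mul_one]
        · rw [abs_of_neg (not_le.1 h), mul_neg_one]
    _ ≤ ‖T n‖ * ‖hmem.toLp‖ := (le_abs_self _).trans ((T n).le_opNorm _)
    _ ≤ ‖T n‖ * 1 := by gcongr
    _ ≤ C := by rw [mul_one]; exact hC n

lemma exists_setIntegral_rpow_le [IsProbabilityMeasure μ] {p : ℝ} (hp : 1 ≤ p)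
    {f : ℕ → Lp ℝ (ENNReal.ofReal p) μ} (hui : UnifIntPow μ p fun n => (f n : Ω → ℝ))
    {C : ℝ} (hC : ∀ n, ∫ x, |f n x| ∂μ ≤ C) {ε : ℝ} (hε : 0 < ε) :
    ∃ L : ℝ, 0 < L ∧ ∀ n, ∫ x in {x | L < |f n x|}, |f n x| ^ p ∂μ ≤ ε := by
  obtain ⟨δ, hδ, h⟩ := hui ε hε
  have hC0 : 0 ≤ C := (integral_nonneg fun x => abs_nonneg _).trans (hC 0)
  refine ⟨(C + 1) / δ, by positivity, fun n => h n _
    (measurableSet_lt measurable_const (Lp.stronglyMeasurable (f n)).measurable.abs) ?_⟩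
  have hint : Integrable (fun x => |f n x|) μ :=
    ((Lp.memLp (f n)).integrable (by simpa using hp)).abs
  have h1 := mul_meas_ge_le_integral_of_nonneg (ae_of_all _ fun x => abs_nonneg (f n x)) hint
    ((C + 1) / δ)
  have h2 : μ.real {x | (C + 1) / δ ≤ |f n x|} ≤ δ := by
    have h3 := h1.trans (hC n)
    rw [div_mul_eq_mul_div, div_le_iff₀ hδ] at h3
    nlinarith
  rw [← ofReal_measureReal]
  refine ENNReal.ofReal_le_ofReal (le_trans (measureReal_mono fun x hx => ?_) h2)
  simp only [Set.mem_ofPred_eq] at hx ⊢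
  exact hx.le

lemma exists_norm_le [IsProbabilityMeasure μ] {p L : ℝ} (hp : 1 ≤ p)
    [Fact (1 ≤ ENNReal.ofReal p)] (hL : 0 < L)
    {f : ℕ → Lp ℝ (ENNReal.ofReal p) μ}
    (h : ∀ n, ∫ x in {x | L < |f n x|}, |f n x| ^ p ∂μ ≤ 1) :
    ∃ B : ℝ, 0 ≤ B ∧ ∀ n, ‖f n‖ ≤ B := by
  have hp0 : 0 < p := by linarith
  refine ⟨(1 + L ^ p) ^ p⁻¹, by positivity, fun n => ?_⟩
  rw [Real.le_rpow_inv_iff_of_pos (norm_nonneg _) (by positivity) hp0, norm_rpow_eq_integral hp]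
  have hms : MeasurableSet {x | L < |f n x|} :=
    measurableSet_lt measurable_const (Lp.stronglyMeasurable (f n)).measurable.abs
  have hi := (Lp.memLp (f n)).integrable_abs_rpow hp
  rw [← integral_add_compl hms hi]
  refine add_le_add (h n) ?_
  calc ∫ x in {x | L < |f n x|}ᶜ, |f n x| ^ p ∂μ
      ≤ ∫ x in {x | L < |f n x|}ᶜ, L ^ p ∂μ := by
        refine setIntegral_mono_on hi.integrableOn (integrable_const _) hms.compl fun x hx => ?_
        have : |f n x| ≤ L := by simpa using hx
        gcongr
    _ ≤ L ^ p := by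
        rw [setIntegral_const, smul_eq_mul]
        exact mul_le_of_le_one_left (by positivity) measureReal_le_one

lemma exists_signs_norm_sum_le {F : Type*} [SeminormedAddCommGroup F] [NormedSpace ℝ F]
    (y : ℕ → F) {c : ℕ → ℝ} (hc : ∀ j, |c j| ≤ 1) (s : Finset ℕ) (x : F) :
    ∃ θ : ℕ → ℝ, (∀ j, θ j = 1 ∨ θ j = -1) ∧
      ‖x + ∑ j ∈ s, c j • y j‖ ≤ ‖x + ∑ j ∈ s, θ j • y j‖ := by
  induction s using Finset.induction_on generalizing x with
  | empty => exact ⟨fun _ => 1, fun _ => Or.inl rfl, by simp⟩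
  | insert a s ha ih =>
    obtain ⟨θ, hθ, h⟩ := ih (x + c a • y a)
    set z := ∑ j ∈ s, θ j • y j with hz
    have hmax : ‖x + c a • y a + z‖ ≤ max ‖x + (1 : ℝ) • y a + z‖ ‖x + (-1 : ℝ) • y a + z‖ := by
      obtain ⟨h1, h2⟩ := abs_le.1 (hc a)
      have hdec : x + c a • y a + z = ((1 + c a) / 2) • (x + (1 : ℝ) • y a + z)
          + ((1 - c a) / 2) • (x + (-1 : ℝ) • y a + z) := by module
      rw [hdec]
      refine (norm_add_le _ _).trans ?_
      rw [norm_smul_of_nonneg (by linarith), norm_smul_of_nonneg (by linarith)]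
      calc _ ≤ (1 + c a) / 2 * max ‖x + (1 : ℝ) • y a + z‖ ‖x + (-1 : ℝ) • y a + z‖
            + (1 - c a) / 2 * max ‖x + (1 : ℝ) • y a + z‖ ‖x + (-1 : ℝ) • y a + z‖ := by
            gcongr
            · linarith
            · exact le_max_left _ _
            · exact le_max_right _ _
        _ = _ := by ring
    obtain ⟨t, ht, hle⟩ : ∃ t : ℝ, (t = 1 ∨ t = -1) ∧
        ‖x + c a • y a + z‖ ≤ ‖x + t • y a + z‖ := by
      rcases le_max_iff.1 hmax with h' | h'
      · exact ⟨1, Or.inl rfl, h'⟩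
      · exact ⟨-1, Or.inr rfl, h'⟩
    refine ⟨Function.update θ a t, fun j => ?_, ?_⟩
    · rcases eq_or_ne j a with rfl | hj
      · simpa using ht
      · simpa [hj] using hθ j
    · have hsum : ∑ j ∈ s, Function.update θ a t j • y j = z :=
        Finset.sum_congr rfl fun j hj => by
          rw [Function.update_of_ne (ne_of_mem_of_not_mem hj ha)]
      rw [Finset.sum_insert ha, Finset.sum_insert ha, hsum, Function.update_self, ← add_assoc,
        ← add_assoc]
      exact h.trans hle

lemma exists_strictMono_of_eventually {Q : ℕ → ℕ → Prop} (h : ∀ N, ∀ᶠ n in atTop, Q N n) :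
    ∃ k : ℕ → ℕ, StrictMono k ∧ ∀ i j, i < j → Q (k i + 1) (k j) := by
  choose t ht using fun N => eventually_atTop.1 (h N)
  let k : ℕ → ℕ := fun i => Nat.rec 0 (fun _ r => max (t (r + 1)) (r + 1)) i
  have hk : ∀ i, k (i + 1) = max (t (k i + 1)) (k i + 1) := fun i => rfl
  have hmono : StrictMono k := strictMono_nat_of_lt_succ fun i => by
    rw [hk]; exact lt_of_lt_of_le (Nat.lt_succ_self _) (le_max_right _ _)
  refine ⟨k, hmono, fun i j hij => ht _ _ ?_⟩
  calc t (k i + 1) ≤ k (i + 1) := by rw [hk]; exact le_max_left _ _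
    _ ≤ k j := hmono.monotone hij

/-- `f n` is almost annihilated by the derivatives of the functions `smoothPow p M`,
`1 ≤ M ≤ N`, at all sums with coefficients in `{-1, 0, 1}` of the functions `f j`, `j < N`. -/
def AlmostOrthogonal (μ : Measure Ω) (p : ℝ) (f : ℕ → Lp ℝ (ENNReal.ofReal p) μ)
    (N n : ℕ) : Prop :=
  ∀ M ∈ Finset.Icc 1 N, ∀ A ∈ (Finset.range N).powerset, ∀ B ∈ (Finset.range N).powerset,
    |∫ x, f n x * smoothPowDeriv p M ((∑ j ∈ A, f j - ∑ j ∈ B, f j :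
      Lp ℝ (ENNReal.ofReal p) μ) x) ∂μ| ≤ (N + 1 : ℝ)⁻¹

lemma eventually_almostOrthogonal [IsFiniteMeasure μ] {p : ℝ} (hp : 1 ≤ p)
    {f : ℕ → Lp ℝ (ENNReal.ofReal p) μ} (hweak : WeaklyNullLp μ (ENNReal.ofReal p) f) (N : ℕ) :
    ∀ᶠ n in atTop, AlmostOrthogonal μ p f N n := by
  refine (Finset.eventually_all _).2 fun M hM => (Finset.eventually_all _).2 fun A _ =>
    (Finset.eventually_all _).2 fun B _ => ?_
  have hM0 : (0 : ℝ) < M := by exact_mod_cast (Finset.mem_Icc.1 hM).1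
  have hD := (Lp.memLp (∑ j ∈ A, f j - ∑ j ∈ B, f j)).smoothPowDeriv hp hM0
  have h := (hweak _ (ofReal_inv_add_inv_div_sub_one hp) hD.toLp).abs
  rw [abs_zero] at h
  filter_upwards [h.eventually_le_const (by positivity : (0 : ℝ) < (N + 1 : ℝ)⁻¹)] with n hn
  refine le_trans (le_of_eq ?_) hn
  congr 1
  refine integral_congr_ae ?_
  filter_upwards [hD.coeFn_toLp] with x hx
  rw [hx]

lemma sum_signs_smul_eq {F : Type*} [AddCommGroup F] [Module ℝ F] (f : ℕ → F) {θ : ℕ → ℝ}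
    (hθ : ∀ j, θ j = 1 ∨ θ j = -1) {r : ℕ → ℕ} (hr : StrictMono r) (s : Finset ℕ) :
    ∑ j ∈ s, θ j • f (r j) =
      ∑ i ∈ (s.filter (θ · = 1)).image r, f i - ∑ i ∈ (s.filter (¬ θ · = 1)).image r, f i := by
  rw [Finset.sum_image hr.injective.injOn, Finset.sum_image hr.injective.injOn,
    ← Finset.sum_filter_add_sum_filter_not s (θ · = 1), sub_eq_add_neg, ← Finset.sum_neg_distrib]
  congr 1
  · refine Finset.sum_congr rfl fun j hj => ?_
    rw [(Finset.mem_filter.1 hj).2, one_smul]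
  · refine Finset.sum_congr rfl fun j hj => ?_
    rw [(hθ j).resolve_left (Finset.mem_filter.1 hj).2, neg_one_smul]

lemma integral_smoothPow_sum_le [IsProbabilityMeasure μ] {p L η : ℝ} (hp1 : 1 ≤ p) (hp2 : p ≤ 2)
    {f : ℕ → Lp ℝ (ENNReal.ofReal p) μ} {k : ℕ → ℕ} (hk : StrictMono k)
    (hQ : ∀ i j, i < j → AlmostOrthogonal μ p f (k i + 1) (k j))
    {M : ℕ} (hM : 0 < M)
    (hη : ∀ n, 6 * ∫ x in {x | L < |f n x|}, |f n x| ^ p ∂μ + (M : ℝ) ^ (p - 2) * L ^ 2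
      + (M : ℝ)⁻¹ ≤ η)
    {m : ℕ → ℕ} (hm : StrictMono m) {θ : ℕ → ℝ} (hθ : ∀ j, θ j = 1 ∨ θ j = -1) (n : ℕ) :
    ∫ x, smoothPow p M ((∑ j ∈ Finset.Ico M (M + n), θ j • f (k (m j)) :
      Lp ℝ (ENNReal.ofReal p) μ) x) ∂μ ≤ (M : ℝ) ^ p + n * η := by
  have hM0 : (0 : ℝ) < M := by exact_mod_cast hM
  induction n with
  | zero =>
    rw [add_zero, Finset.Ico_self, Finset.sum_empty]
    have : ∫ x, smoothPow p M ((0 : Lp ℝ (ENNReal.ofReal p) μ) x) ∂μ = ∫ _, (M : ℝ) ^ p ∂μ := by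
      refine integral_congr_ae ?_
      filter_upwards [Lp.coeFn_zero ℝ (ENNReal.ofReal p) μ] with x hx
      rw [hx, Pi.zero_apply, smoothPow, zero_pow two_ne_zero, add_zero, sq_rpow_half hM0.le]
    rw [this]
    simp
  | succ n ih =>
    set S : Lp ℝ (ENNReal.ofReal p) μ := ∑ j ∈ Finset.Ico M (M + n), θ j • f (k (m j)) with hS
    set v := f (k (m (M + n))) with hv
    have hθ1 : |θ (M + n)| = 1 := by rcases hθ (M + n) with h | h <;> simp [h]
    have hsum : ∑ j ∈ Finset.Ico M (M + (n + 1)), θ j • f (k (m j)) = S + θ (M + n) • v := by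
      rw [← add_assoc, Finset.sum_Ico_succ_top (Nat.le_add_right M n)]
    have hae : ∫ x, smoothPow p M ((S + θ (M + n) • v : Lp ℝ (ENNReal.ofReal p) μ) x) ∂μ
        = ∫ x, smoothPow p M (S x + θ (M + n) * v x) ∂μ := by
      refine integral_congr_ae ?_
      filter_upwards [Lp.coeFn_add S (θ (M + n) • v), Lp.coeFn_smul (θ (M + n)) v] with x h1 h2
      rw [h1, Pi.add_apply, h2, Pi.smul_apply, smul_eq_mul]
    have hstep := integral_smoothPow_add_le (L := L) hp1 hp2 hM0 (Lp.memLp S) (Lp.memLp v)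
      (Lp.stronglyMeasurable v).measurable hθ1
    have hcross : θ (M + n) * ∫ x, v x * smoothPowDeriv p M (S x) ∂μ ≤ (M : ℝ)⁻¹ := by
      refine (le_abs_self _).trans ?_
      rw [abs_mul, hθ1, one_mul]
      have hlt : m (M + n - 1) < m (M + n) := hm (by omega)
      have hN : M + n ≤ k (m (M + n - 1)) + 1 := by
        have := (hk.comp hm).le_apply (x := M + n - 1)
        simp only [Function.comp_apply] at this
        omega
      have hsub : ∀ P : ℕ → Prop, ∀ _ : DecidablePred P,
          ((Finset.Ico M (M + n)).filter P).image (k ∘ m) ∈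
            (Finset.range (k (m (M + n - 1)) + 1)).powerset := by
        intro P _
        rw [Finset.mem_powerset]
        intro i hi
        obtain ⟨j, hj, rfl⟩ := Finset.mem_image.1 hi
        have hj' := (Finset.mem_Ico.1 (Finset.mem_filter.1 hj).1).2
        rw [Finset.mem_range, Nat.lt_succ_iff]
        exact (hk.comp hm).monotone (by omega)
      have h := hQ _ _ hlt M (Finset.mem_Icc.2 ⟨hM, by omega⟩) _ (hsub (θ · = 1) inferInstance)
        _ (hsub (¬ θ · = 1) inferInstance)
      rw [← sum_signs_smul_eq f hθ (hk.comp hm)] at h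
      refine h.trans ?_
      gcongr
      have : (M : ℝ) ≤ ((k (m (M + n - 1)) + 1 : ℕ) : ℝ) := by exact_mod_cast (by omega)
      linarith
    rw [hsum, hae]
    push_cast
    linarith [hη (k (m (M + n)))]

end

/-- (Commutative case of Corollary 3.8.) -/
theorem statement10
    {Ω : Type*} [MeasurableSpace Ω] (μ : Measure Ω) [IsProbabilityMeasure μ]
    (hμ : Atomless μ)
    (p : ℝ) (hp1 : 1 ≤ p) (hp2 : p < 2)
    [Fact (1 ≤ ENNReal.ofReal p)]
    (f : ℕ → Lp ℝ (ENNReal.ofReal p) μ)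
    (hweak : WeaklyNullLp μ (ENNReal.ofReal p) f)
    (hui : UnifIntPow μ p fun n => (f n : Ω → ℝ)) :
    ∃ k : ℕ → ℕ, StrictMono k ∧
      ∀ ε : ℝ, 0 < ε → ∃ N : ℕ, ∀ n, N ≤ n → ∀ m : ℕ → ℕ, StrictMono m →
        ∀ sgn : ℕ → ℝ, (∀ j, |sgn j| ≤ 1) →
          (n : ℝ) ^ (-(1 / p)) * ‖∑ j ∈ Finset.range n, sgn j • f (k (m j))‖ ≤ ε := by
  obtain ⟨C, hC⟩ := exists_integral_abs_le_of_weaklyNullLp hp1 hweak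
  obtain ⟨B, hB0, hB⟩ : ∃ B : ℝ, 0 ≤ B ∧ ∀ n, ‖f n‖ ≤ B := by
    obtain ⟨L, hL, h⟩ := exists_setIntegral_rpow_le hp1 hui hC one_pos
    exact exists_norm_le hp1 hL h
  obtain ⟨k, hk, hQ⟩ := exists_strictMono_of_eventually (eventually_almostOrthogonal hp1 hweak)
  refine ⟨k, hk, fun ε hε => ?_⟩
  have hp0 : 0 < p := by linarith
  set e := ε / 2 with he
  have he0 : 0 < e := by positivity
  set η := e ^ p / 2 with hη
  have hη0 : 0 < η := by positivity
  obtain ⟨L, hL, htail⟩ := exists_setIntegral_rpow_le hp1 hui hC (by positivity : 0 < η / 18)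
  obtain ⟨M, hM, hM1, hM2⟩ : ∃ M : ℕ, 0 < M ∧ (M : ℝ) ^ (p - 2) * L ^ 2 ≤ η / 3 ∧
      (M : ℝ)⁻¹ ≤ η / 3 := by
    have h1 : Tendsto (fun M : ℕ => (M : ℝ) ^ (p - 2) * L ^ 2) atTop (nhds 0) := by
      have h := ((tendsto_rpow_neg_atTop (by linarith : 0 < 2 - p)).comp
        (tendsto_natCast_atTop_atTop (R := ℝ))).mul_const (L ^ 2)
      simpa using h
    exact ((eventually_gt_atTop 0).and ((h1.eventually_le_const (by positivity)).and
      (tendsto_inv_atTop_nhds_zero_nat.eventually_le_const (by positivity)))).exists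
  have hN : ∀ᶠ n : ℕ in atTop, M ≤ n ∧ (M : ℝ) ^ p / η ≤ n ∧ M * B / e ≤ (n : ℝ) ^ (1 / p) :=
    (eventually_ge_atTop M).and ((tendsto_natCast_atTop_atTop.eventually_ge_atTop _).and
      (((tendsto_rpow_atTop (by positivity)).comp
        tendsto_natCast_atTop_atTop).eventually_ge_atTop _))
  obtain ⟨N, hN⟩ := eventually_atTop.1 hN
  refine ⟨N, fun n hn m hm sgn hsgn => ?_⟩
  obtain ⟨hMn, hn1, hn2⟩ := hN n hn
  have hn0 : (0 : ℝ) < n := by exact_mod_cast hM.trans_le hMn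
  rw [div_le_iff₀ hη0] at hn1
  rw [div_le_iff₀ he0] at hn2
  have hhead : ‖∑ j ∈ Finset.range M, sgn j • f (k (m j))‖ ≤ M * B := by
    refine (norm_sum_le_of_le _ (f := fun j => sgn j • f (k (m j))) (n := fun _ => B)
      fun j _ => ?_).trans (by simp)
    rw [norm_smul, Real.norm_eq_abs]
    exact (mul_le_of_le_one_left (norm_nonneg _) (hsgn j)).trans (hB _)
  have htl : ‖∑ j ∈ Finset.Ico M n, sgn j • f (k (m j))‖ ≤ (n : ℝ) ^ (1 / p) * e := by
    obtain ⟨θ, hθ, hle⟩ := exists_signs_norm_sum_le (fun j => f (k (m j))) hsgn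
      (Finset.Ico M n) 0
    rw [zero_add, zero_add] at hle
    refine hle.trans ?_
    rw [← Real.rpow_le_rpow_iff (norm_nonneg _) (by positivity) hp0,
      Real.mul_rpow (by positivity) he0.le, ← Real.rpow_mul hn0.le, one_div_mul_cancel hp0.ne',
      Real.rpow_one, norm_rpow_eq_integral hp1]
    have h := integral_smoothPow_sum_le hp1 hp2.le hk hQ hM
      (fun n => by linarith [htail n] : ∀ n, 6 * ∫ x in {x | L < |f n x|}, |f n x| ^ p ∂μ
        + (M : ℝ) ^ (p - 2) * L ^ 2 + (M : ℝ)⁻¹ ≤ η) hm hθ (n - M)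
    rw [Nat.add_sub_cancel' hMn] at h
    have hT := Lp.memLp (∑ j ∈ Finset.Ico M n, θ j • f (k (m j)))
    have hle2 := integral_mono (hT.integrable_abs_rpow hp1)
      (hT.integrable_smoothPow hp1 (by exact_mod_cast hM : (0 : ℝ) < M))
      fun x => abs_rpow_le_smoothPow hp0.le M _
    refine (hle2.trans h).trans ?_
    have hnM : ((n - M : ℕ) : ℝ) * η ≤ n * η := by
      gcongr
      exact Nat.sub_le n M
    have : (n : ℝ) * e ^ p = n * η + n * η := by rw [hη]; ring
    linarith
  have hrn : (0 : ℝ) < (n : ℝ) ^ (1 / p) := by positivity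
  rw [Real.rpow_neg hn0.le, inv_mul_le_iff₀ hrn, ← Finset.sum_range_add_sum_Ico _ hMn]
  refine (norm_add_le _ _).trans ((add_le_add (hhead.trans hn2) htl).trans (le_of_eq ?_))
  rw [he]
  ring

end
end

section
/- (Commutative case of Lemma 3.12.) Let (Ω, μ) be a measure space and let f_1, f_2, … be a finite or infinite sequence in L^1(μ) with ‖f_i‖_{L^1(μ)} ≤ 1 for all i. Assume there are pairwise disjoint measurable sets P_1, P_2, … and 0 < ε < δ ≤ 1 such that for all i: ∫_{P_i} |f_i| dμ ≥ δ and ∑_{j≠i} ∫_{P_j} |f_i| dμ ≤ ε. Then the sequence (f_i) is 1/(δ−ε)-equivalent to the usual basis of ℓ^1 (of ℓ^1_n if the sequence has n terms). -/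
open MeasureTheory Filter
open scoped ENNReal NNReal BigOperators

noncomputable section

variable {E : Type*} [NormedAddCommGroup E] [NormedSpace ℝ E]

/-- The integral of `|h|` over `A` is the norm of the restriction of `h` to `A`. -/
theorem norm_LpToLpRestrictCLM_one {Ω : Type*} [MeasurableSpace Ω] (μ : Measure Ω)
    (A : Set Ω) (h : Lp ℝ 1 μ) :
    ‖LpToLpRestrictCLM Ω ℝ ℝ μ 1 A h‖ = ∫ x in A, |(h : Ω → ℝ) x| ∂μ := by
  rw [L1.norm_eq_integral_norm]
  refine integral_congr_ae ?_
  filter_upwards [LpToLpRestrictCLM_coeFn (p := 1) ℝ A h] with x hx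
  rw [hx, Real.norm_eq_abs]

/-- Integrals of `|h|` over disjoint sets add up to at most the `L¹` norm of `h`. -/
theorem sum_setIntegral_abs_le_norm {Ω : Type*} [MeasurableSpace Ω] (μ : Measure Ω)
    {ι : Type*} {P : ι → Set Ω} (hPmeas : ∀ i, MeasurableSet (P i))
    (hPdisj : Pairwise (Function.onFun Disjoint P)) (s : Finset ι) (h : Lp ℝ 1 μ) :
    ∑ i ∈ s, ∫ x in P i, |(h : Ω → ℝ) x| ∂μ ≤ ‖h‖ := by
  have hint : Integrable (fun x => |(h : Ω → ℝ) x|) μ := (L1.integrable_coeFn h).abs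
  rw [L1.norm_eq_integral_norm, ← integral_biUnion_finset s (fun i _ => hPmeas i)
    (fun i _ j _ hij => hPdisj hij) (fun i _ => hint.integrableOn)]
  exact setIntegral_le_integral hint (Eventually.of_forall fun x => abs_nonneg _)

/-- A sum of restrictions that is diagonally dominant is bounded below. -/
theorem sub_mul_sum_abs_le_norm_sum_smul {Ω : Type*} [MeasurableSpace Ω] (μ : Measure Ω)
    {ι : Type*} [DecidableEq ι] (s : Finset ι) (f : ι → Lp ℝ 1 μ)
    {P : ι → Set Ω} (hPmeas : ∀ i, MeasurableSet (P i))
    (hPdisj : Pairwise (Function.onFun Disjoint P)) {δ ε : ℝ}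
    (hbig : ∀ i ∈ s, δ ≤ ∫ x in P i, |(f i : Ω → ℝ) x| ∂μ)
    (hsmall : ∀ i ∈ s, ∑ j ∈ s.erase i, ∫ x in P j, |(f i : Ω → ℝ) x| ∂μ ≤ ε) (a : ι → ℝ) :
    (δ - ε) * ∑ i ∈ s, |a i| ≤ ‖∑ i ∈ s, a i • f i‖ := by
  refine le_trans ?_ (sum_setIntegral_abs_le_norm μ hPmeas hPdisj s _)
  simp only [← norm_LpToLpRestrictCLM_one] at hbig hsmall ⊢
  set T := fun i => LpToLpRestrictCLM Ω ℝ ℝ μ 1 (P i)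
  have hrow : ∀ i ∈ s, |a i| * ‖T i (f i)‖ - ∑ k ∈ s.erase i, |a k| * ‖T i (f k)‖
      ≤ ‖T i (∑ k ∈ s, a k • f k)‖ := by
    intro i hi
    have hoff : ‖T i (∑ k ∈ s.erase i, a k • f k)‖ ≤ ∑ k ∈ s.erase i, |a k| * ‖T i (f k)‖ := by
      rw [map_sum]
      refine (norm_sum_le _ _).trans_eq (Finset.sum_congr rfl fun k _ => ?_)
      rw [map_smul, norm_smul, Real.norm_eq_abs]
    have hdiag : ‖T i (a i • f i)‖ = |a i| * ‖T i (f i)‖ := by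
      rw [map_smul, norm_smul, Real.norm_eq_abs]
    rw [← Finset.add_sum_erase s _ hi, map_add, ← hdiag]
    have := norm_sub_le_norm_add (T i (a i • f i)) (T i (∑ k ∈ s.erase i, a k • f k))
    linarith
  have hswap : ∑ i ∈ s, ∑ k ∈ s.erase i, |a k| * ‖T i (f k)‖
      = ∑ k ∈ s, |a k| * ∑ i ∈ s.erase k, ‖T i (f k)‖ := by
    simp only [Finset.mul_sum]
    refine Finset.sum_comm' fun i k => ?_
    simp only [Finset.mem_erase]
    tauto
  calc (δ - ε) * ∑ i ∈ s, |a i|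
      = ∑ i ∈ s, |a i| * δ - ∑ k ∈ s, |a k| * ε := by simp only [← Finset.sum_mul]; ring
    _ ≤ ∑ i ∈ s, |a i| * ‖T i (f i)‖ - ∑ k ∈ s, |a k| * ∑ i ∈ s.erase k, ‖T i (f k)‖ :=
        sub_le_sub
          (Finset.sum_le_sum fun i hi => mul_le_mul_of_nonneg_left (hbig i hi) (abs_nonneg _))
          (Finset.sum_le_sum fun i hi => mul_le_mul_of_nonneg_left (hsmall i hi) (abs_nonneg _))
    _ = ∑ i ∈ s, (|a i| * ‖T i (f i)‖ - ∑ k ∈ s.erase i, |a k| * ‖T i (f k)‖) := by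
        rw [Finset.sum_sub_distrib, hswap]
    _ ≤ ∑ i ∈ s, ‖T i (∑ k ∈ s, a k • f k)‖ := Finset.sum_le_sum hrow

/-- (Commutative case of Lemma 3.12.) -/
theorem statement11
    {Ω : Type*} [MeasurableSpace Ω] (μ : Measure Ω)
    (f : ℕ → Lp ℝ 1 μ) (hf : ∀ i, ‖f i‖ ≤ 1)
    (P : ℕ → Set Ω) (hPmeas : ∀ i, MeasurableSet (P i))
    (hPdisj : Pairwise (Function.onFun Disjoint P))
    (δ ε : ℝ) (hε0 : 0 < ε) (hεδ : ε < δ) (hδ1 : δ ≤ 1)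
    (hbig : ∀ i, δ ≤ ∫ x in P i, |(f i : Ω → ℝ) x| ∂μ)
    (hsmall : ∀ i,
      (∑' j : ℕ, if j = i then 0 else ∫ x in P j, |(f i : Ω → ℝ) x| ∂μ) ≤ ε) :
    IsLqBasisEquiv 1 (1 / (δ - ε)) f := by
  intro s a
  simp only [Real.rpow_one, div_one, one_div_one_div]
  have hK : 1 ≤ 1 / (δ - ε) := by
    rw [le_div_iff₀ (by linarith)]
    linarith
  refine ⟨sub_mul_sum_abs_le_norm_sum_smul μ s f hPmeas hPdisj (fun i _ => hbig i) ?_ a, ?_⟩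
  · intro i _
    refine le_trans ?_ (hsmall i)
    have hnonneg : ∀ j, 0 ≤ ∫ x in P j, |(f i : Ω → ℝ) x| ∂μ := fun j =>
      integral_nonneg fun x => abs_nonneg _
    have hoff_nonneg : ∀ j, 0 ≤ if j = i then 0 else ∫ x in P j, |(f i : Ω → ℝ) x| ∂μ := by
      intro j
      split_ifs
      exacts [le_rfl, hnonneg j]
    have hsum : Summable fun j => ∫ x in P j, |(f i : Ω → ℝ) x| ∂μ :=
      summable_of_sum_le hnonneg fun u => sum_setIntegral_abs_le_norm μ hPmeas hPdisj u (f i)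
    have hoff_sum : Summable fun j => if j = i then 0 else ∫ x in P j, |(f i : Ω → ℝ) x| ∂μ := by
      refine hsum.of_nonneg_of_le hoff_nonneg fun j => ?_
      split_ifs
      exacts [hnonneg j, le_rfl]
    refine le_trans (Finset.sum_congr rfl fun j hj => ?_).le
      (hoff_sum.sum_le_tsum (s.erase i) fun j _ => hoff_nonneg j)
    rw [if_neg (Finset.ne_of_mem_erase hj)]
  · calc ‖∑ k ∈ s, a k • f k‖ ≤ ∑ k ∈ s, |a k| := by
          refine (norm_sum_le _ _).trans (Finset.sum_le_sum fun k _ => ?_)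
          rw [norm_smul, Real.norm_eq_abs]
          exact mul_le_of_le_one_right (abs_nonneg _) (hf k)
      _ ≤ 1 / (δ - ε) * ∑ k ∈ s, |a k| :=
          le_mul_of_one_le_left (Finset.sum_nonneg fun k _ => abs_nonneg _) hK

end
end

section
/- (Commutative case of Lemma 3.13.) Let k ≥ 1 and 0 < ε < 1 be given, and set ℓ = ⌊1/ε⌋ + 1 and n = k^ℓ. Then for every measure space (Ω, μ), every f_1, …, f_n ∈ L^1(μ) with ‖f_i‖_{L^1(μ)} ≤ 1 for all i, and all pairwise disjoint measurable sets P_1, …, P_n ⊆ Ω, there exist indices j_1 < j_2 < ⋯ < j_k such that for all 1 ≤ i ≤ k: ∑_{r≠i, 1≤r≤k} ∫_{P_{j_r}} |f_{j_i}| dμ < ε. -/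
open MeasureTheory Filter
open scoped ENNReal NNReal BigOperators

noncomputable section

variable {E : Type*} [NormedAddCommGroup E] [NormedSpace ℝ E]

theorem exists_pairwise_disjoint_subsets_of_card_eq_mul {ι : Type*} [DecidableEq ι]
    {k m : ℕ} (S : Finset ι) (hS : S.card = k * m) :
    ∃ A : Fin k → Finset ι, (∀ t, A t ⊆ S) ∧ (∀ t, (A t).card = m) ∧
      Pairwise (Function.onFun Disjoint A) := by
  let e : Fin k × Fin m ≃ S := finProdFinEquiv.trans (S.equivFinOfCardEq hS).symm
  have he : ∀ {t t' : Fin k} {x x' : Fin m},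
      (e (t, x) : ι) = e (t', x') → t = t' ∧ x = x' := fun h =>
    Prod.ext_iff.mp (e.injective (Subtype.ext h))
  refine ⟨fun t => Finset.univ.image fun x => (e (t, x) : ι), fun t i hi => ?_, fun t => ?_,
    fun t t' htt' => Finset.disjoint_left.mpr fun i hi hi' => ?_⟩
  · obtain ⟨x, -, rfl⟩ := Finset.mem_image.mp hi
    exact (e (t, x)).2
  · rw [Finset.card_image_of_injective _ fun x x' h => (he h).2, Finset.card_fin]
  · obtain ⟨x, -, rfl⟩ := Finset.mem_image.mp hi
    obtain ⟨x', -, h⟩ := Finset.mem_image.mp hi'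
    exact htt' (he h).1.symm

/-- For a nonnegative matrix indexed by `k ^ l` elements, either some `k` of the indices span a
submatrix whose off-diagonal row sums are all less than `ε`, or some off-diagonal row sum of the
whole matrix is at least `l * ε`. -/
theorem exists_small_offDiag_row_sums_or_le_row_sum {ι : Type*} [DecidableEq ι] {a : ι → ι → ℝ}
    (ha : ∀ i r, 0 ≤ a i r) (k : ℕ) (ε : ℝ) (l : ℕ) (S : Finset ι) (hS : S.card = k ^ l) :
    (∃ T : Finset ι, T.card = k ∧ ∀ i ∈ T, ∑ r ∈ T.erase i, a i r < ε) ∨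
      ∃ i ∈ S, l * ε ≤ ∑ r ∈ S.erase i, a i r := by
  induction l generalizing S with
  | zero =>
    obtain ⟨i, rfl⟩ := Finset.card_eq_one.mp (hS.trans (pow_zero k))
    exact Or.inr ⟨i, by simp⟩
  | succ l ih =>
    by_contra! hcon
    obtain ⟨hT, hrow⟩ := hcon
    obtain ⟨A, hAS, hAcard, hAdisj⟩ :=
      exists_pairwise_disjoint_subsets_of_card_eq_mul S (hS.trans (pow_succ' k l))
    have hA : ∀ t, ∃ i ∈ A t, l * ε ≤ ∑ r ∈ (A t).erase i, a i r := fun t =>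
      (ih (A t) (hAcard t)).resolve_left fun ⟨T, hTcard, hsmall⟩ => by
        obtain ⟨i, hi, hle⟩ := hT T hTcard
        exact (hsmall i hi).not_ge hle
    choose v hv hsum using hA
    have hmem : ∀ {t t'}, v t ∈ A t' → t = t' := fun {t t'} h => by
      by_contra hne
      exact Finset.disjoint_left.mp (hAdisj hne) (hv t) h
    have hinj : Function.Injective v := fun t t' h => hmem (h ▸ hv t')
    obtain ⟨i, hi, hle⟩ := hT (Finset.univ.image v)
      (by rw [Finset.card_image_of_injective _ hinj, Finset.card_fin])
    obtain ⟨t, -, rfl⟩ := Finset.mem_image.mp hi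
    have hdisj : Disjoint ((A t).erase (v t)) ((Finset.univ.image v).erase (v t)) := by
      refine Finset.disjoint_left.mpr fun r hr hr' => ?_
      obtain ⟨hne, hr'⟩ := Finset.mem_erase.mp hr'
      obtain ⟨t', -, rfl⟩ := Finset.mem_image.mp hr'
      exact hne (congrArg v (hmem (Finset.mem_of_mem_erase hr)))
    have hsub : (A t).erase (v t) ∪ (Finset.univ.image v).erase (v t) ⊆ S.erase (v t) := by
      rw [← Finset.erase_union_distrib]
      refine Finset.erase_subset_erase _ (Finset.union_subset (hAS t) fun r hr => ?_)
      obtain ⟨t', -, rfl⟩ := Finset.mem_image.mp hr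
      exact hAS t' (hv t')
    have htotal := Finset.sum_le_sum_of_subset_of_nonneg hsub fun r _ _ => ha (v t) r
    rw [Finset.sum_union hdisj] at htotal
    have hlt := hrow (v t) (hAS t (hv t))
    push_cast at hlt
    linarith [hsum t]

theorem sum_setIntegral_abs_le_integral_abs {Ω ι : Type*} [MeasurableSpace Ω] {μ : Measure Ω}
    {f : Ω → ℝ} (hf : Integrable f μ) {P : ι → Set Ω} (hPmeas : ∀ i, MeasurableSet (P i))
    (hPdisj : Pairwise (Function.onFun Disjoint P)) (s : Finset ι) :
    ∑ r ∈ s, ∫ x in P r, |f x| ∂μ ≤ ∫ x, |f x| ∂μ := by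
  rw [← integral_biUnion_finset s (fun r _ => hPmeas r) (fun r _ r' _ h => hPdisj h)
    fun r _ => hf.abs.integrableOn]
  exact setIntegral_le_integral hf.abs (Eventually.of_forall fun x => abs_nonneg (f x))

/-- (Commutative case of Lemma 3.13.) -/
theorem statement12 (k : ℕ) (hk : 1 ≤ k) (ε : ℝ) (hε0 : 0 < ε) (hε1 : ε < 1)
    {Ω : Type*} [MeasurableSpace Ω] (μ : Measure Ω)
    (f : Fin (k ^ (Nat.floor (1 / ε) + 1)) → Ω → ℝ)
    (hint : ∀ i, Integrable (f i) μ)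
    (hf : ∀ i, ∫ x, |f i x| ∂μ ≤ 1)
    (P : Fin (k ^ (Nat.floor (1 / ε) + 1)) → Set Ω)
    (hPmeas : ∀ i, MeasurableSet (P i))
    (hPdisj : Pairwise (Function.onFun Disjoint P)) :
    ∃ j : Fin k → Fin (k ^ (Nat.floor (1 / ε) + 1)), StrictMono j ∧
      ∀ i : Fin k, ∑ r ∈ Finset.univ.erase i, ∫ x in P (j r), |f (j i) x| ∂μ < ε := by
  classical
  rcases exists_small_offDiag_row_sums_or_le_row_sum
      (a := fun i r => ∫ x in P r, |f i x| ∂μ)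
      (fun i r => integral_nonneg fun x => abs_nonneg (f i x)) k ε (Nat.floor (1 / ε) + 1)
      Finset.univ (Finset.card_fin _) with ⟨T, hTcard, hT⟩ | ⟨i, -, hi⟩
  · refine ⟨T.orderEmbOfFin hTcard, (T.orderEmbOfFin hTcard).strictMono, fun i => ?_⟩
    have himage : (Finset.univ.erase i).map (T.orderEmbOfFin hTcard).toEmbedding =
        T.erase (T.orderEmbOfFin hTcard i) := by
      rw [Finset.map_erase, Finset.map_orderEmbOfFin_univ]
      rfl
    have hsmall := hT _ (T.orderEmbOfFin_mem hTcard i)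
    rw [← himage, Finset.sum_map] at hsmall
    exact hsmall
  · have hle := hi.trans
      ((sum_setIntegral_abs_le_integral_abs (hint i) hPmeas hPdisj _).trans (hf i))
    have hlt := (div_lt_iff₀ hε0).mp (Nat.lt_floor_add_one (1 / ε))
    push_cast at hle
    linarith

end
end

section
/- (Lemma 3.14 B.) Let k ∈ ℕ and ε > 0 be given, and set ℓ = ⌊1/ε⌋ + 1 and N = k^ℓ. Then for all non-negative functions f_1, …, f_N : {1,…,N} → [0,∞) with ∑_{m=1}^N f_i(m) ≤ 1 for each i, there exist indices n_1 < n_2 < ⋯ < n_k in {1,…,N} such that for all 1 ≤ i ≤ k: ∑_{j≠i, 1≤j≤k} f_{n_i}(n_j) < ε. -/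
open MeasureTheory Filter
open scoped ENNReal NNReal BigOperators

noncomputable section

variable {E : Type*} [NormedAddCommGroup E] [NormedSpace ℝ E]

/-- If every `k`-element subset of a set with `k ^ l` elements contains a point `i` such that `f i`
has mass at least `ε` on the rest of that subset, then for some `i` the function `f i` has mass at
least `l * ε` off `i`. -/
theorem exists_mul_le_sum_erase {k : ℕ} {ε : ℝ} (l : ℕ) {α : Type} [Fintype α] [DecidableEq α]
    (hcard : Fintype.card α = k ^ l) (f : α → α → ℝ) (hnn : ∀ i m, 0 ≤ f i m)
    (hbad : ∀ T : Finset α, T.card = k → ∃ i ∈ T, ε ≤ ∑ m ∈ T.erase i, f i m) :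
    ∃ i, l * ε ≤ ∑ m ∈ Finset.univ.erase i, f i m := by
  induction l generalizing α with
  | zero =>
    have : Nonempty α := Fintype.card_pos_iff.mp (by simp [hcard])
    refine ⟨Classical.arbitrary α, ?_⟩
    rw [Nat.cast_zero, zero_mul]
    exact Finset.sum_nonneg fun m _ => hnn _ m
  | succ l ih =>
    have e : Fin (k ^ l) × Fin k ≃ α := Fintype.equivOfCardEq (by simp [hcard, pow_succ])
    let block (a : Fin (k ^ l)) : Finset α :=
      Finset.univ.map ((Function.Embedding.sectR a (Fin k)).trans e.toEmbedding)
    have hblock (a m) : m ∈ block a ↔ (e.symm m).1 = a := by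
      simp only [block, Finset.mem_map, Finset.mem_univ, true_and]
      constructor
      · rintro ⟨x, rfl⟩
        simp
      · rintro rfl
        exact ⟨(e.symm m).2, by simp⟩
    choose c hc hcε using fun a => hbad (block a) (by simp [block])
    have hc' (a) : (e.symm (c a)).1 = a := (hblock a _).1 (hc a)
    have hinj : Function.Injective c := fun a b h => by rw [← hc' a, h, hc' b]
    obtain ⟨a, ha⟩ := ih (by simp) (fun a b => f (c a) (c b)) (fun _ _ => hnn _ _) (by
      intro T hT
      obtain ⟨i, hi, hle⟩ := hbad (T.map ⟨c, hinj⟩) (by simpa using hT)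
      obtain ⟨b, hb, rfl⟩ := Finset.mem_map.1 hi
      refine ⟨b, hb, ?_⟩
      rwa [← Finset.map_erase, Finset.sum_map] at hle)
    refine ⟨c a, ?_⟩
    have hdisj : Disjoint ((Finset.univ.erase a).map ⟨c, hinj⟩) ((block a).erase (c a)) := by
      rw [Finset.disjoint_left]
      intro m hm hm'
      obtain ⟨b, hb, rfl⟩ := Finset.mem_map.1 hm
      exact Finset.ne_of_mem_erase hb
        ((hc' b).symm.trans ((hblock a _).1 (Finset.mem_of_mem_erase hm')))
    have hsub : ((Finset.univ.erase a).map ⟨c, hinj⟩) ∪ ((block a).erase (c a)) ⊆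
        Finset.univ.erase (c a) := by
      rw [Finset.map_erase]
      exact Finset.union_subset (Finset.erase_subset_erase _ (Finset.subset_univ _))
        (Finset.erase_subset_erase _ (Finset.subset_univ _))
    calc ((l + 1 : ℕ) : ℝ) * ε = l * ε + ε := by push_cast; ring
      _ ≤ ∑ b ∈ Finset.univ.erase a, f (c a) (c b) + ∑ m ∈ (block a).erase (c a), f (c a) m :=
        add_le_add ha (hcε a)
      _ = ∑ m ∈ (Finset.univ.erase a).map ⟨c, hinj⟩ ∪ (block a).erase (c a), f (c a) m := by
        rw [Finset.sum_union hdisj, Finset.sum_map]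
        rfl
      _ ≤ _ := Finset.sum_le_sum_of_subset_of_nonneg hsub fun m _ _ => hnn _ m

/-- (Lemma 3.14 B.) -/
theorem statement14 (k : ℕ) (ε : ℝ) (hε : 0 < ε)
    (f : Fin (k ^ (Nat.floor (1 / ε) + 1)) → Fin (k ^ (Nat.floor (1 / ε) + 1)) → ℝ)
    (hnn : ∀ i m, 0 ≤ f i m) (hf : ∀ i, ∑ m, f i m ≤ 1) :
    ∃ n : Fin k → Fin (k ^ (Nat.floor (1 / ε) + 1)), StrictMono n ∧
      ∀ i : Fin k, ∑ j ∈ Finset.univ.erase i, f (n i) (n j) < ε := by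
  by_contra! hcon
  obtain ⟨i, hi⟩ := exists_mul_le_sum_erase (k := k) (ε := ε) (Nat.floor (1 / ε) + 1) (by simp)
    f hnn (by
      intro T hT
      obtain ⟨i, hi⟩ := hcon (T.orderEmbOfFin hT) (T.orderEmbOfFin hT).strictMono
      refine ⟨T.orderEmbOfFin hT i, T.orderEmbOfFin_mem hT i, hi.trans_eq ?_⟩
      have hT' : T.erase (T.orderEmbOfFin hT i) =
          (Finset.univ.erase i).map (T.orderEmbOfFin hT).toEmbedding := by
        rw [Finset.map_erase, T.map_orderEmbOfFin_univ hT]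
        rfl
      rw [hT', Finset.sum_map]
      rfl)
  have hle : ∑ m ∈ Finset.univ.erase i, f i m ≤ 1 :=
    (Finset.sum_le_sum_of_subset_of_nonneg (Finset.erase_subset _ _) fun m _ _ => hnn i m).trans
      (hf i)
  have hlt : 1 < ((Nat.floor (1 / ε) + 1 : ℕ) : ℝ) * ε := by
    rw [← div_lt_iff₀ hε]
    exact_mod_cast Nat.lt_floor_add_one (1 / ε)
  linarith

end
end

section
/- (Sublemma in the proof of Lemma 6.4.) Let 1 ≤ p < 2, let H be a Hilbert space, and let T : L^p([0,1]) → H be a bounded linear operator, where [0,1] carries Lebesgue measure. Then for every ε > 0 there exists f ∈ L^p([0,1]) taking only the values 1 and −1 (almost everywhere) such that ‖Tf‖ < ε. In fact, for every n ∈ ℕ there exist signs η_1, …, η_n ∈ {1,−1} such that ‖T(∑_{j=1}^n η_j · 1_{[(j−1)/n, j/n)})‖ ≤ ‖T‖ · n^{1/2 − 1/p}. -/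
open MeasureTheory Filter
open scoped ENNReal NNReal BigOperators

noncomputable section

variable {E : Type*} [NormedAddCommGroup E] [NormedSpace ℝ E]

/-- The step function `1_{[j/n, (j+1)/n)}` as an element of `L^p([0,1])`. -/
noncomputable def stepLp (p : ℝ≥0∞) (n : ℕ) (j : Fin n) :
    Lp ℝ p (volume.restrict (Set.Icc (0:ℝ) 1)) :=
  indicatorConstLp p
    (measurableSet_Ico : MeasurableSet (Set.Ico ((j : ℝ) / n) (((j : ℝ) + 1) / n)))
    (by
      apply ne_of_lt
      calc volume.restrict (Set.Icc (0:ℝ) 1) (Set.Ico ((j : ℝ) / n) (((j : ℝ) + 1) / n))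
          ≤ volume (Set.Ico ((j : ℝ) / n) (((j : ℝ) + 1) / n)) :=
            Measure.restrict_apply_le _ _
        _ < ⊤ := by rw [Real.volume_Ico]; exact ENNReal.ofReal_lt_top)
    (1 : ℝ)

/-- In a real inner product space, signs can be chosen so that the signed sum of a finite family
has squared norm at most the sum of the squared norms. -/
theorem exists_signs_norm_sq_sum_le {ι H : Type*} [NormedAddCommGroup H] [InnerProductSpace ℝ H]
    (x : ι → H) (s : Finset ι) :
    ∃ η : ι → ℝ, (∀ j, η j = 1 ∨ η j = -1) ∧
      ‖∑ j ∈ s, η j • x j‖ ^ 2 ≤ ∑ j ∈ s, ‖x j‖ ^ 2 := by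
  classical
  induction s using Finset.induction_on with
  | empty => exact ⟨fun _ => 1, fun _ => Or.inl rfl, by simp⟩
  | insert a s ha ih =>
    obtain ⟨η, hη, hle⟩ := ih
    have key : ∀ c : ℝ, ∑ j ∈ insert a s, Function.update η a c j • x j =
        c • x a + ∑ j ∈ s, η j • x j := by
      intro c
      rw [Finset.sum_insert ha, Function.update_self]
      congr 1
      refine Finset.sum_congr rfl fun j hj => ?_
      rw [Function.update_of_ne (ne_of_mem_of_not_mem hj ha)]
    have signs : ∀ c : ℝ, (c = 1 ∨ c = -1) →
        ∀ j, Function.update η a c j = 1 ∨ Function.update η a c j = -1 := by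
      intro c hc j
      rcases eq_or_ne j a with rfl | hj
      · simpa using hc
      · simpa [hj] using hη j
    rcases le_total (inner ℝ (x a) (∑ j ∈ s, η j • x j)) 0 with h | h
    · refine ⟨Function.update η a 1, signs 1 (Or.inl rfl), ?_⟩
      rw [key, one_smul, Finset.sum_insert ha, norm_add_sq_real]
      linarith
    · refine ⟨Function.update η a (-1), signs (-1) (Or.inr rfl), ?_⟩
      rw [key, neg_one_smul, Finset.sum_insert ha, norm_add_sq_real, inner_neg_left, norm_neg]
      linarith

theorem norm_stepLp_le {p : ℝ} (hp : 0 < p) (n : ℕ) (j : Fin n) :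
    ‖stepLp (ENNReal.ofReal p) n j‖ ≤ ((n : ℝ)⁻¹) ^ (1 / p) := by
  have hμ : (volume.restrict (Set.Icc (0 : ℝ) 1)).real
      (Set.Ico ((j : ℝ) / n) (((j : ℝ) + 1) / n)) ≤ (n : ℝ)⁻¹ := by
    refine ENNReal.toReal_le_of_le_ofReal (by positivity) ?_
    refine (Measure.restrict_apply_le _ _).trans ?_
    rw [Real.volume_Ico, ← sub_div, add_sub_cancel_left, one_div]
  rw [stepLp, norm_indicatorConstLp (by simpa using hp) ENNReal.ofReal_ne_top, norm_one, one_mul,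
    ENNReal.toReal_ofReal hp.le]
  gcongr

theorem exists_signs_norm_map_sum_stepLp_le {p : ℝ} (hp : 0 < p) [Fact (1 ≤ ENNReal.ofReal p)]
    {H : Type*} [NormedAddCommGroup H] [InnerProductSpace ℝ H]
    (T : Lp ℝ (ENNReal.ofReal p) (volume.restrict (Set.Icc (0 : ℝ) 1)) →L[ℝ] H)
    {n : ℕ} (hn : 0 < n) :
    ∃ η : Fin n → ℝ, (∀ j, η j = 1 ∨ η j = -1) ∧
      ‖T (∑ j, η j • stepLp (ENNReal.ofReal p) n j)‖ ≤
        ‖T‖ * (n : ℝ) ^ ((1 : ℝ) / 2 - 1 / p) := by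
  obtain ⟨η, hη, hle⟩ := exists_signs_norm_sq_sum_le
    (fun j : Fin n => T (stepLp (ENNReal.ofReal p) n j)) Finset.univ
  refine ⟨η, hη, ?_⟩
  have hn' : (0 : ℝ) < n := Nat.cast_pos.2 hn
  simp only [map_sum, map_smul]
  refine le_of_sq_le_sq ?_ (by positivity)
  calc _ ≤ ∑ j : Fin n, ‖T (stepLp (ENNReal.ofReal p) n j)‖ ^ 2 := hle
    _ ≤ ∑ _j : Fin n, (‖T‖ * ((n : ℝ)⁻¹) ^ (1 / p)) ^ 2 := by
        gcongr with j
        exact T.le_opNorm_of_le (norm_stepLp_le hp n j)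
    _ = (‖T‖ * (n : ℝ) ^ ((1 : ℝ) / 2 - 1 / p)) ^ 2 := by
        rw [Finset.sum_const, Finset.card_univ, Fintype.card_fin, nsmul_eq_mul,
          Real.rpow_sub hn', Real.inv_rpow hn'.le, ← Real.sqrt_eq_rpow, mul_pow, mul_pow, div_pow,
          Real.sq_sqrt hn'.le]
        ring

theorem sum_smul_stepLp_ae_eq_one_or_neg_one (p : ℝ≥0∞) {n : ℕ} (hn : 0 < n) {η : Fin n → ℝ}
    (hη : ∀ j, η j = 1 ∨ η j = -1) :
    ∀ᵐ x ∂(volume.restrict (Set.Icc (0 : ℝ) 1)),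
      ((∑ j, η j • stepLp p n j : Lp ℝ p (volume.restrict (Set.Icc (0 : ℝ) 1))) : ℝ → ℝ) x = 1 ∨
      ((∑ j, η j • stepLp p n j : Lp ℝ p (volume.restrict (Set.Icc (0 : ℝ) 1))) : ℝ → ℝ) x
        = -1 := by
  have hn' : (0 : ℝ) < n := Nat.cast_pos.2 hn
  have hsmul : ∀ᵐ x ∂(volume.restrict (Set.Icc (0 : ℝ) 1)), ∀ j : Fin n,
      (η j • stepLp p n j : Lp ℝ p (volume.restrict (Set.Icc (0 : ℝ) 1))) x =
        η j * (Set.Ico ((j : ℝ) / n) (((j : ℝ) + 1) / n)).indicator (fun _ => (1 : ℝ)) x := by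
    rw [ae_all_iff]
    intro j
    filter_upwards [Lp.coeFn_smul (η j) (stepLp p n j),
      indicatorConstLp_coeFn (p := p) (hs := (measurableSet_Ico :
        MeasurableSet (Set.Ico ((j : ℝ) / n) (((j : ℝ) + 1) / n))))
        (hμs := measure_ne_top (volume.restrict (Set.Icc (0 : ℝ) 1)) _) (c := (1 : ℝ))]
      with x h₁ h₂
    rw [h₁, Pi.smul_apply, smul_eq_mul]
    exact congrArg (η j * ·) h₂
  filter_upwards [Lp.coeFn_finsetSum Finset.univ (fun j => η j • stepLp p n j), hsmul,
    ae_restrict_mem measurableSet_Icc, Measure.ae_ne (volume.restrict (Set.Icc (0 : ℝ) 1)) 1]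
    with x hsum hx hmem hne
  have hx1 : x < 1 := lt_of_le_of_ne hmem.2 hne
  have hfloor : ⌊x * n⌋₊ < n := by
    rw [Nat.floor_lt (mul_nonneg hmem.1 hn'.le)]
    nlinarith
  have hiff : ∀ j : Fin n, x ∈ Set.Ico ((j : ℝ) / n) (((j : ℝ) + 1) / n) ↔ j = ⟨_, hfloor⟩ := by
    intro j
    rw [Set.mem_Ico, div_le_iff₀ hn', lt_div_iff₀ hn', Fin.ext_iff, eq_comm,
      Nat.floor_eq_iff (mul_nonneg hmem.1 hn'.le)]
  rw [hsum]
  simp only [Finset.sum_apply, hx, Set.indicator_apply, hiff, mul_ite, mul_one, mul_zero,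
    Finset.sum_ite_eq', Finset.mem_univ, if_true]
  simpa using hη _

/-- (Sublemma in the proof of Lemma 6.4.) -/
theorem statement15 (p : ℝ) (hp1 : 1 ≤ p) (hp2 : p < 2)
    [Fact (1 ≤ ENNReal.ofReal p)]
    {H : Type*} [NormedAddCommGroup H] [InnerProductSpace ℝ H] [CompleteSpace H]
    (T : Lp ℝ (ENNReal.ofReal p) (volume.restrict (Set.Icc (0:ℝ) 1)) →L[ℝ] H) :
    (∀ ε : ℝ, 0 < ε →
      ∃ f : Lp ℝ (ENNReal.ofReal p) (volume.restrict (Set.Icc (0:ℝ) 1)),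
        (∀ᵐ x ∂(volume.restrict (Set.Icc (0:ℝ) 1)),
          (f : ℝ → ℝ) x = 1 ∨ (f : ℝ → ℝ) x = -1) ∧ ‖T f‖ < ε) ∧
    (∀ n : ℕ, 0 < n → ∃ η : Fin n → ℝ, (∀ j, η j = 1 ∨ η j = -1) ∧
      ‖T (∑ j, η j • stepLp (ENNReal.ofReal p) n j)‖ ≤
        ‖T‖ * (n : ℝ) ^ ((1 : ℝ) / 2 - 1 / p)) := by
  have hp : 0 < p := one_pos.trans_le hp1
  refine ⟨fun ε hε => ?_, fun n hn => exists_signs_norm_map_sum_stepLp_le hp T hn⟩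
  have hexp : 0 < 1 / p - (1 : ℝ) / 2 := sub_pos.2 (one_div_lt_one_div_of_lt hp hp2)
  have hlim : Tendsto (fun n : ℕ => ‖T‖ * (n : ℝ) ^ ((1 : ℝ) / 2 - 1 / p)) atTop (nhds 0) := by
    simpa using ((tendsto_rpow_neg_atTop hexp).comp tendsto_natCast_atTop_atTop).const_mul ‖T‖
  obtain ⟨n, hlt, hn⟩ := ((hlim.eventually_lt_const hε).and (eventually_gt_atTop 0)).exists
  obtain ⟨η, hη, hle⟩ := exists_signs_norm_map_sum_stepLp_le hp T hn
  exact ⟨_, sum_smul_stepLp_ae_eq_one_or_neg_one _ hn hη, hle.trans_lt hlt⟩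

end
end
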